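/- Let r be either the rational r-matrix r₁₂(λ,μ) = P₁₂/(μ−λ) or the trigonometric r-matrix r^trig₁₂(λ,μ) = μP₁₂/(μ−λ) − P⁻₁₂ − ½P⁰₁₂, and let Q = (Q^a(λ_a))_{a∈ℂP¹} be any gl_N-valued adelic element. Then the two orders of expansion of the r-matrix kernel give the same bracket with Q: for all a, b ∈ ℂP¹, [ Tr₂( ι_{λ_a} ι_{μ_b} r₁₂(λ,μ) Q^b(μ_b)₂ ), Q^a(λ_a) ] = [ Tr₂( ι_{μ_b} ι_{λ_a} r₁₂(λ,μ) Q^b(μ_b)₂ ), Q^a(λ_a) ], as an identity of doubly formal series in λ_a and μ_b with coefficients in gl_N(ℂ). -/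

import Mathlib

/-!
# The two orders of double expansion give the same bracket with `Q`

For `r` the rational r-matrix `P₁₂/(μ−λ)` or the trigonometric r-matrix
`μP₁₂/(μ−λ) − P⁻₁₂ − ½P⁰₁₂`, and any `gl_N`-valued adelic element
`Q = (Q^a(λ_a))_{a∈ℂP¹}`, one has for all `a, b ∈ ℂP¹`:
`[ Tr₂( ι_{λ_a}ι_{μ_b} r₁₂(λ,μ) Q^b(μ_b)₂ ), Q^a(λ_a) ]
  = [ Tr₂( ι_{μ_b}ι_{λ_a} r₁₂(λ,μ) Q^b(μ_b)₂ ), Q^a(λ_a) ]`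
as doubly formal series in `λ_a` and `μ_b` (stated coefficientwise).

Using `Tr₂(P₁₂M₂) = M`, `Tr₂(P⁻₁₂M₂) = P⁻M`, `Tr₂(P⁰₁₂M₂) = P⁰M`, the integrand is the
double expansion of the scalar kernel (`1/(μ−λ)`, resp. `μ/(μ−λ)`) Cauchy-multiplied with
the `μ_b`-series `Q^b(μ_b)`, minus (in the trigonometric case) the `λ`-constant part
`(P⁻+½P⁰)Q^b(μ_b)`.  The bracket is a Cauchy product in `λ_a`.
-/

set_option synthInstance.maxHeartbeats 400000
noncomputable section
open Polynomial

abbrev Rf : Type := RatFunc ℂ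
abbrev Rf2 : Type := RatFunc Rf
/-- `ℂP¹ = ℂ ∪ {∞}`; `none` is the point at infinity -/
abbrev CP1 : Type := Option ℂ
abbrev glC (N : ℕ) : Type := Matrix (Fin N) (Fin N) ℂ
abbrev AdeleData (N : ℕ) : Type := CP1 → ℤ → glC N

def laurentCoeffAt {F : Type*} [Field F] (b : F) (f : RatFunc F) (n : ℤ) : F :=
  ((RatFunc.laurent b f : LaurentSeries F)).coeff n

def invSubst {F : Type*} [Field F] (f : RatFunc F) : RatFunc F :=
  (algebraMap F[X] (RatFunc F) f.num.reverse * RatFunc.X ^ f.denom.natDegree) /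
    (algebraMap F[X] (RatFunc F) f.denom.reverse * RatFunc.X ^ f.num.natDegree)

/-- `ι_{λ_a}`: coefficient of `λ_a^n` in the Laurent expansion at `a ∈ ℂP¹` -/
def expC {F : Type*} [Field F] (a : Option F) (f : RatFunc F) (n : ℤ) : F :=
  match a with
  | some b => laurentCoeffAt b f n
  | none => ((invSubst f : LaurentSeries F)).coeff n

def pt (b : CP1) : Option Rf := b.map (algebraMap ℂ Rf)

/-- `1/(μ−λ)`, outer variable `μ` -/
def cMuOuter : Rf2 := (RatFunc.X - RatFunc.C (RatFunc.X : Rf))⁻¹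
/-- `1/(μ−λ)`, outer variable `λ` -/
def cLamOuter : Rf2 := (RatFunc.C (RatFunc.X : Rf) - RatFunc.X)⁻¹
/-- `μ/(μ−λ)`, outer variable `μ` -/
def sMuOuter : Rf2 := RatFunc.X * (RatFunc.X - RatFunc.C (RatFunc.X : Rf))⁻¹
/-- `μ/(μ−λ)`, outer variable `λ` -/
def sLamOuter : Rf2 := RatFunc.C (RatFunc.X : Rf) * (RatFunc.C (RatFunc.X : Rf) - RatFunc.X)⁻¹

/-- `ι_{λ_a}ι_{μ_b} s` (expand first in `μ_b`, then in `λ_a`); `s` has outer variable `μ` -/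
def dMuFirst (s : Rf2) (a b : CP1) (t m : ℤ) : ℂ := expC a (expC (pt b) s m) t
/-- `ι_{μ_b}ι_{λ_a} s` (expand first in `λ_a`, then in `μ_b`); `s` has outer variable `λ` -/
def dLamFirst (s : Rf2) (a b : CP1) (t m : ℤ) : ℂ := expC b (expC (pt a) s t) m

def lowP {N : ℕ} (M : glC N) : glC N := Matrix.of fun i j => if j < i then M i j else 0
def diagP {N : ℕ} (M : glC N) : glC N := Matrix.of fun i j => if i = j then M i j else 0

def LaurentBdd {N : ℕ} (X : AdeleData N) : Prop := ∀ a, ∃ M : ℤ, ∀ n, n < M → X a n = 0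
def AlmostTaylor {N : ℕ} (X : AdeleData N) : Prop := {a : CP1 | ∃ n, n < 0 ∧ X a n ≠ 0}.Finite
def IsAdele {N : ℕ} (X : AdeleData N) : Prop := LaurentBdd X ∧ AlmostTaylor X

/-- `Tr₂(d r₁₂ Q^b(μ_b)₂)` for a given double expansion `d` of the scalar kernel;
`cpart = true` includes the constant part `−(P⁻+½P⁰)Q^b(μ_b)` of the trigonometric
r-matrix.  Coefficient of `λ_a^t μ_b^m`. -/
def TrIota {N : ℕ} (d : CP1 → CP1 → ℤ → ℤ → ℂ) (cpart : Bool)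
    (Q : AdeleData N) (a b : CP1) (t m : ℤ) : glC N :=
  (∑ᶠ p : ℤ, d a b t p • Q b (m - p))
    - (if cpart = true ∧ t = 0 then lowP (Q b m) + (2:ℂ)⁻¹ • diagP (Q b m) else 0)

/-- bracket `[T(λ_a,μ_b), Q^a(λ_a)]`, a Cauchy product in `λ_a`; coefficient of
`λ_a^t μ_b^m` -/
def brkt {N : ℕ} (T : ℤ → ℤ → glC N) (Q : AdeleData N) (a : CP1) (t m : ℤ) : glC N :=
  ∑ᶠ u : ℤ, (T u m * Q a (t - u) - Q a (t - u) * T u m)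

section Expansion
variable {F : Type*} [Field F]

/-- The image of the coordinate function in the Laurent series field at a point. -/
def localX (a : Option F) : LaurentSeries F :=
  match a with
  | some b => HahnSeries.single 1 1 + HahnSeries.C b
  | none => HahnSeries.single (-1) 1

lemma coe_algebraMap_polynomial (p : F[X]) :
    ((algebraMap F[X] (RatFunc F) p : RatFunc F) : LaurentSeries F)
      = p.eval₂ HahnSeries.C (HahnSeries.single 1 1) := by
  induction p using Polynomial.induction_on' with
  | add p q hp hq => simp only [map_add, Polynomial.eval₂_add, hp, hq]
  | monomial n c =>
    rw [← Polynomial.C_mul_X_pow_eq_monomial]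
    have hC : ((algebraMap F[X] (RatFunc F) (Polynomial.C c) : RatFunc F) : LaurentSeries F)
        = HahnSeries.C c := by
      refine (RatFunc.coe_coe (Polynomial.C c)).symm.trans ?_
      rw [Polynomial.coe_C, PowerSeries.coe_C]
    rw [map_mul, map_mul, map_pow, map_pow, RatFunc.algebraMap_X, RatFunc.coe_X, hC]
    simp

lemma coe_ratFunc_C (c : F) :
    ((RatFunc.C c : RatFunc F) : LaurentSeries F) = HahnSeries.C c := by
  rw [← RatFunc.algebraMap_C, coe_algebraMap_polynomial, Polynomial.eval₂_C]

lemma eval₂_reverse_mul_pow_of_mul_eq_one {R S : Type*} [CommSemiring R] [CommSemiring S]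
    (i : R →+* S) {x y : S} (h : x * y = 1) (p : R[X]) :
    p.reverse.eval₂ i y * x ^ p.natDegree = p.eval₂ i x := by
  let _ : Invertible x := ⟨y, by rw [mul_comm, h], h⟩
  exact Polynomial.eval₂_reverse_mul_pow i x p

lemma single_neg_one_mul_single_one :
    (HahnSeries.single (-1) 1 : LaurentSeries F) * HahnSeries.single 1 1 = 1 := by
  simp

lemma eval₂_reverse_mul_single_neg_one_pow (p : F[X]) :
    p.reverse.eval₂ HahnSeries.C (HahnSeries.single 1 1 : LaurentSeries F)
        * (HahnSeries.single (-1) 1) ^ p.natDegree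
      = p.eval₂ HahnSeries.C (HahnSeries.single (-1) 1) :=
  eval₂_reverse_mul_pow_of_mul_eq_one _ single_neg_one_mul_single_one p

lemma eval₂_single_neg_one_ne_zero {p : F[X]} (hp : p ≠ 0) :
    p.eval₂ HahnSeries.C (HahnSeries.single (-1) 1 : LaurentSeries F) ≠ 0 := by
  rw [← eval₂_reverse_mul_single_neg_one_pow, ← coe_algebraMap_polynomial]
  refine mul_ne_zero ?_ (pow_ne_zero _ (by simp))
  rw [Ne, FaithfulSMul.algebraMap_eq_zero_iff, FaithfulSMul.algebraMap_eq_zero_iff]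
  simpa using hp

lemma coe_invSubst (f : RatFunc F) :
    (invSubst f : LaurentSeries F)
      = f.num.eval₂ HahnSeries.C (HahnSeries.single (-1) 1)
        / f.denom.eval₂ HahnSeries.C (HahnSeries.single (-1) 1) := by
  have hs : (HahnSeries.single (-1) 1 : LaurentSeries F) = (HahnSeries.single 1 1)⁻¹ :=
    eq_inv_of_mul_eq_one_left single_neg_one_mul_single_one
  have h1 : (HahnSeries.single 1 1 : LaurentSeries F) ≠ 0 := by simp
  rw [← eval₂_reverse_mul_single_neg_one_pow f.num, ← eval₂_reverse_mul_single_neg_one_pow f.denom,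
    invSubst, map_div₀, map_mul, map_mul, map_pow, map_pow, RatFunc.coe_X,
    coe_algebraMap_polynomial, coe_algebraMap_polynomial, hs, inv_pow, inv_pow]
  by_cases h : f.denom.reverse.eval₂ HahnSeries.C (HahnSeries.single 1 1 : LaurentSeries F) = 0
  · simp [h]
  · field_simp

/-- Laurent expansion at a point of the projective line is a ring homomorphism. -/
lemma exists_expHom (a : Option F) : ∃ L : RatFunc F →+* LaurentSeries F,
    (∀ f n, expC a f n = (L f).coeff n) ∧ L RatFunc.X = localX a ∧
      ∀ c, L (RatFunc.C c) = HahnSeries.C c := by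
  cases a with
  | some b =>
    refine ⟨{ toFun := fun f => ((RatFunc.laurent b f : RatFunc F) : LaurentSeries F)
              map_one' := by rw [map_one, map_one]
              map_zero' := by rw [map_zero, map_zero]
              map_mul' := fun f g => by rw [map_mul, map_mul]
              map_add' := fun f g => by rw [map_add, map_add] },
      fun f n => rfl, ?_, fun c => ?_⟩
    · change ((RatFunc.laurent b RatFunc.X : RatFunc F) : LaurentSeries F) = _
      rw [RatFunc.laurent_X, map_add, RatFunc.coe_X, coe_ratFunc_C]
      rfl
    · change ((RatFunc.laurent b (RatFunc.C c) : RatFunc F) : LaurentSeries F) = _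
      rw [RatFunc.laurent_C, coe_ratFunc_C]
  | none =>
    have h : nonZeroDivisors F[X] ≤ (nonZeroDivisors (LaurentSeries F)).comap
        (Polynomial.eval₂RingHom HahnSeries.C (HahnSeries.single (-1) 1 : LaurentSeries F)) := by
      intro p hp
      rw [Submonoid.mem_comap, mem_nonZeroDivisors_iff_ne_zero]
      exact eval₂_single_neg_one_ne_zero (nonZeroDivisors.ne_zero hp)
    refine ⟨RatFunc.liftRingHom _ h, fun f n => ?_, ?_, fun c => ?_⟩
    · rw [RatFunc.liftRingHom_apply]
      change (invSubst f : LaurentSeries F).coeff n = _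
      rw [coe_invSubst]
      rfl
    · rw [← RatFunc.algebraMap_X, RatFunc.liftRingHom_algebraMap]
      simp [localX]
    · rw [← RatFunc.algebraMap_C, RatFunc.liftRingHom_algebraMap]
      simp

/-- Laurent expansion at a point of the projective line. -/
def expHom (a : Option F) : RatFunc F →+* LaurentSeries F := (exists_expHom a).choose

lemma expC_eq_coeff (a : Option F) (f : RatFunc F) (n : ℤ) : expC a f n = (expHom a f).coeff n :=
  (exists_expHom a).choose_spec.1 f n

@[simp] lemma expHom_X (a : Option F) : expHom a RatFunc.X = localX a :=
  (exists_expHom a).choose_spec.2.1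

@[simp] lemma expHom_C (a : Option F) (c : F) : expHom a (RatFunc.C c) = HahnSeries.C c :=
  (exists_expHom a).choose_spec.2.2 c

lemma exists_expC_eq_zero_of_lt (a : Option F) (f : RatFunc F) :
    ∃ M : ℤ, ∀ n < M, expC a f n = 0 :=
  ⟨(expHom a f).order, fun _ hn => by
    rw [expC_eq_coeff, HahnSeries.coeff_eq_zero_of_lt_order hn]⟩

/-- The powers of the geometric series. -/
lemma inv_one_sub_pow_succ (b : F) (n : ℕ) :
    ((1 - HahnSeries.C b * HahnSeries.single 1 1 : LaurentSeries F)⁻¹) ^ (n + 1)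
      = ((PowerSeries.mk fun k => (Nat.choose (n + k) n : F) * b ^ k : PowerSeries F) :
          LaurentSeries F) := by
  have key : (PowerSeries.mk fun k => (Nat.choose (n + k) n : F) * b ^ k)
      * (1 - PowerSeries.C b * PowerSeries.X) ^ (n + 1) = 1 := by
    have h := congrArg (PowerSeries.rescale b) (PowerSeries.mk_one_mul_one_sub_eq_one F)
    rw [map_mul, map_sub, map_one, PowerSeries.rescale_X] at h
    have e : (PowerSeries.mk fun k => (Nat.choose (n + k) n : F) * b ^ k)
        = PowerSeries.rescale b (PowerSeries.mk 1) ^ (n + 1) := by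
      rw [← map_pow, PowerSeries.mk_one_pow_eq_mk_choose_add, PowerSeries.rescale_mk]
      ext k
      simp [mul_comm]
    rw [e, ← mul_pow, h, one_pow]
  rw [inv_pow, eq_comm]
  refine eq_inv_of_mul_eq_one_left ?_
  rw [← PowerSeries.coe_X, ← PowerSeries.coe_C, ← PowerSeries.coe_one, ← PowerSeries.coe_mul,
    ← PowerSeries.coe_sub, ← PowerSeries.coe_pow, ← PowerSeries.coe_mul, key]

lemma coeff_inv_one_sub_pow_succ (b : F) (n : ℕ) (t : ℤ) :
    (((1 - HahnSeries.C b * HahnSeries.single 1 1 : LaurentSeries F)⁻¹) ^ (n + 1)).coeff t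
      = if 0 ≤ t then (Nat.choose (n + t.toNat) n : F) * b ^ t.toNat else 0 := by
  rw [inv_one_sub_pow_succ, PowerSeries.coeff_coe]
  by_cases ht : 0 ≤ t
  · lift t to ℕ using ht
    simp
  · simp [ht, not_le.mp ht]

end Expansion

section Expansion
variable {F : Type*} [Field F]

lemma expC_some_X_mul (b : F) (f : RatFunc F) (t : ℤ) :
    expC (some b) (RatFunc.X * f) t = expC (some b) f (t - 1) + b * expC (some b) f t := by
  simp only [expC_eq_coeff, map_mul, expHom_X, localX]
  rw [add_mul, HahnSeries.coeff_add, HahnSeries.coeff_single_mul, one_mul,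
    HahnSeries.C_apply, HahnSeries.coeff_single_zero_mul]

lemma expC_none_X_mul (f : RatFunc F) (t : ℤ) :
    expC none (RatFunc.X * f) t = expC none f (t + 1) := by
  simp only [expC_eq_coeff, map_mul, expHom_X, localX]
  rw [HahnSeries.coeff_single_mul, one_mul, sub_neg_eq_add]

lemma expC_C_mul (a : Option F) (c : F) (f : RatFunc F) (t : ℤ) :
    expC a (RatFunc.C c * f) t = c * expC a f t := by
  simp only [expC_eq_coeff, map_mul, expHom_C]
  rw [HahnSeries.C_apply, HahnSeries.coeff_single_zero_mul]

lemma expC_add (a : Option F) (f g : RatFunc F) (t : ℤ) :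
    expC a (f + g) t = expC a f t + expC a g t := by
  simp only [expC_eq_coeff, map_add, HahnSeries.coeff_add]

lemma expC_neg (a : Option F) (f : RatFunc F) (t : ℤ) :
    expC a (-f) t = -expC a f t := by
  simp only [expC_eq_coeff, map_neg, HahnSeries.coeff_neg]

lemma expC_zero (a : Option F) (t : ℤ) : expC a (0 : RatFunc F) t = 0 := by
  simp only [expC_eq_coeff, map_zero, HahnSeries.coeff_zero]

lemma expC_one (a : Option F) (t : ℤ) : expC a (1 : RatFunc F) t = if t = 0 then 1 else 0 := by
  rw [expC_eq_coeff, map_one, HahnSeries.coeff_one]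
  congr

lemma expC_some_inv_pow {b y : F} (h : y ≠ b) (n : ℕ) (t : ℤ) :
    expC (some b) ((RatFunc.X - RatFunc.C y)⁻¹ ^ (n + 1)) t
      = if 0 ≤ t then (-(y - b)⁻¹) ^ (n + 1)
          * ((Nat.choose (n + t.toNat) n : F) * (y - b)⁻¹ ^ t.toNat) else 0 := by
  have hy : y - b ≠ 0 := sub_ne_zero.mpr h
  have e : expHom (some b) (RatFunc.X - RatFunc.C y)
      = (HahnSeries.C (-(y - b)⁻¹))⁻¹
        * (1 - HahnSeries.C (y - b)⁻¹ * HahnSeries.single 1 1) := by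
    rw [← map_inv₀, map_sub, expHom_X, expHom_C, localX, inv_neg, inv_inv, mul_sub, mul_one,
      ← mul_assoc, ← map_mul, neg_mul, mul_inv_cancel₀ hy]
    simp only [map_neg, map_sub, map_one]
    ring
  rw [expC_eq_coeff, map_pow, map_inv₀, e, mul_inv, inv_inv, mul_pow, ← map_pow,
    HahnSeries.C_apply, HahnSeries.coeff_single_zero_mul, coeff_inv_one_sub_pow_succ]
  simp only [mul_ite, mul_zero]

lemma expC_some_inv_pow_self (b : F) (n : ℕ) (t : ℤ) :
    expC (some b) ((RatFunc.X - RatFunc.C b)⁻¹ ^ (n + 1)) t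
      = if t = -(n + 1) then 1 else 0 := by
  have e : expHom (some b) (RatFunc.X - RatFunc.C b)⁻¹ = HahnSeries.single (-1) 1 := by
    rw [map_inv₀, map_sub, expHom_X, expHom_C, localX, add_sub_cancel_right]
    exact (eq_inv_of_mul_eq_one_left single_neg_one_mul_single_one).symm
  rw [expC_eq_coeff, map_pow, e, HahnSeries.single_pow, one_pow, HahnSeries.coeff_single]
  congr 1
  simp

lemma expC_none_inv_pow (y : F) (n : ℕ) (t : ℤ) :
    expC none ((RatFunc.X - RatFunc.C y)⁻¹ ^ (n + 1)) t
      = if n + 1 ≤ t then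
          (Nat.choose (n + (t - (n + 1)).toNat) n : F) * y ^ (t - (n + 1)).toNat else 0 := by
  have e : expHom none (RatFunc.X - RatFunc.C y)
      = (HahnSeries.single 1 1)⁻¹ * (1 - HahnSeries.C y * HahnSeries.single 1 1) := by
    have h1 : (HahnSeries.single 1 1 : LaurentSeries F) ≠ 0 := by simp
    rw [map_sub, expHom_X, expHom_C, localX,
      eq_inv_of_mul_eq_one_left single_neg_one_mul_single_one]
    field_simp
  rw [expC_eq_coeff, map_pow, map_inv₀, e, mul_inv, inv_inv, mul_pow, HahnSeries.single_pow,
    one_pow, HahnSeries.coeff_single_mul, one_mul, coeff_inv_one_sub_pow_succ]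
  simp

lemma expC_none_X_pow (n : ℕ) (t : ℤ) :
    expC none ((RatFunc.X : RatFunc F) ^ n) t = if t = -n then 1 else 0 := by
  rw [expC_eq_coeff, map_pow, expHom_X, localX, HahnSeries.single_pow, one_pow,
    HahnSeries.coeff_single]
  simp

lemma expC_some_X_pow (b : F) (n : ℕ) (t : ℤ) :
    expC (some b) ((RatFunc.X : RatFunc F) ^ n) t
      = if 0 ≤ t then b ^ (n - t.toNat) * (Nat.choose n t.toNat : F) else 0 := by
  have e : expHom (some b) ((RatFunc.X : RatFunc F) ^ n)
      = (((Polynomial.X + Polynomial.C b) ^ n : F[X]) : PowerSeries F) := by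
    rw [map_pow, expHom_X, localX, Polynomial.coe_pow, PowerSeries.coe_pow, Polynomial.coe_add,
      PowerSeries.coe_add, Polynomial.coe_X, Polynomial.coe_C, PowerSeries.coe_X, PowerSeries.coe_C]
  rw [expC_eq_coeff, e, PowerSeries.coeff_coe]
  by_cases ht : 0 ≤ t
  · lift t to ℕ using ht
    rw [if_neg (by simp), Int.natAbs_natCast, Polynomial.coeff_coe, Polynomial.coeff_X_add_C_pow]
    simp
  · simp [ht, not_le.mp ht]

lemma ratFunc_X_ne_C (b : F) : (RatFunc.X : RatFunc F) ≠ RatFunc.C b := by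
  intro h
  have h' := congrArg (fun f => expC none f (-1)) h
  have hX := expC_none_X_pow (F := F) 1 (-1)
  have hC := expC_C_mul none b 1 (-1)
  rw [pow_one] at hX
  rw [mul_one] at hC
  simp only [hX, hC, expC_one] at h'
  simp at h'

lemma inv_sub_comm_eq_neg (x y : F) : (x - y)⁻¹ = -(y - x)⁻¹ := by
  rw [neg_inv, neg_sub]

lemma mul_inv_sub_eq_one_add {x y : F} (h : x ≠ y) :
    x * (x - y)⁻¹ = 1 + y * (x - y)⁻¹ := by
  have := sub_ne_zero.mpr h
  field_simp
  ring

end Expansion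

/-- Coefficient of `μ_b^m` in the expansion of `1/(μ−λ)` at `b`, a rational function of `λ`. -/
def kerC (b : CP1) (m : ℤ) : Rf :=
  match b with
  | some b => if 0 ≤ m then -((RatFunc.X - RatFunc.C b)⁻¹ ^ (m.toNat + 1)) else 0
  | none => if 1 ≤ m then RatFunc.X ^ (m - 1).toNat else 0

lemma expC_pt_cMuOuter (b : CP1) (m : ℤ) : expC (pt b) cMuOuter m = kerC b m := by
  cases b with
  | some b =>
    have h := expC_some_inv_pow (ratFunc_X_ne_C b) 0 m
    rw [zero_add, pow_one] at h
    rw [pt, Option.map_some, RatFunc.algebraMap_eq_C, cMuOuter, h, kerC]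
    simp only [zero_add, pow_one, Nat.choose_zero_right, Nat.cast_one, one_mul]
    rw [pow_succ', neg_mul]
  | none =>
    have h := expC_none_inv_pow (RatFunc.X : Rf) 0 m
    rw [zero_add, pow_one] at h
    rw [pt, Option.map_none, cMuOuter, h, kerC]
    simp

lemma cLamOuter_eq : cLamOuter = -cMuOuter :=
  inv_sub_comm_eq_neg (RatFunc.C (RatFunc.X : Rf)) RatFunc.X

lemma sMuOuter_eq : sMuOuter = 1 + RatFunc.C (RatFunc.X : Rf) * cMuOuter :=
  mul_inv_sub_eq_one_add (ratFunc_X_ne_C (RatFunc.X : Rf))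

lemma sLamOuter_eq : sLamOuter = 1 + RatFunc.X * cLamOuter :=
  mul_inv_sub_eq_one_add (ratFunc_X_ne_C (RatFunc.X : Rf)).symm

/-- The difference of the two double expansions of `1/(μ−λ)` is a function of `t + m`. -/
def deltaCoeff (a b : CP1) : ℤ → ℂ :=
  if a = b then
    match a with
    | some _ => Pi.single (-1) (-1)
    | none => Pi.single 1 1
  else 0

lemma expC_kerC_none_some (b : ℂ) (t m : ℤ) :
    expC none (kerC (some b) m) t + expC (some b) (kerC none t) m = 0 := by
  unfold kerC
  by_cases hm : 0 ≤ m <;> by_cases ht : 1 ≤ t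
  · simp only [hm, ht, if_true, expC_neg, expC_none_inv_pow, expC_some_X_pow]
    lift m to ℕ using hm
    obtain ⟨s, rfl⟩ := Int.le.dest ht
    simp only [Int.toNat_natCast, add_sub_cancel_left]
    by_cases h : m ≤ s
    · obtain ⟨k, rfl⟩ := Nat.exists_eq_add_of_le h
      have h1 : (m : ℤ) + 1 ≤ 1 + ((m + k : ℕ) : ℤ) := by push_cast; omega
      have h2 : (1 + ((m + k : ℕ) : ℤ) - ((m : ℤ) + 1)).toNat = k := by push_cast; omega
      rw [if_pos h1, h2, Nat.add_sub_cancel_left]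
      ring
    · have h1 : ¬ (m : ℤ) + 1 ≤ 1 + (s : ℤ) := by omega
      rw [if_neg h1, Nat.choose_eq_zero_of_lt (not_le.mp h)]
      simp
  · simp only [hm, ht, if_true, if_false, expC_neg, expC_zero, expC_none_inv_pow]
    rw [if_neg (by omega)]
    simp
  · simp only [hm, ht, if_true, if_false, expC_zero, expC_some_X_pow, add_zero]
  · simp only [hm, ht, if_false, expC_zero, add_zero]

lemma expC_kerC_none_none (t m : ℤ) :
    expC none (kerC none m) t + expC none (kerC none t) m = if t + m = 1 then 1 else 0 := by
  unfold kerC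
  by_cases hm : 1 ≤ m <;> by_cases ht : 1 ≤ t <;>
    simp only [hm, ht, if_true, if_false, expC_zero, expC_none_X_pow] <;>
    split_ifs <;> first | omega | simp

lemma expC_kerC_self (b : ℂ) (t m : ℤ) :
    expC (some b) (kerC (some b) m) t + expC (some b) (kerC (some b) t) m
      = if t + m = -1 then -1 else 0 := by
  unfold kerC
  by_cases hm : 0 ≤ m <;> by_cases ht : 0 ≤ t <;>
    simp only [hm, ht, if_true, if_false, expC_zero, expC_neg, expC_some_inv_pow_self] <;>
    split_ifs <;> first | omega | simp

lemma expC_kerC_some_some {a b : ℂ} (hab : a ≠ b) (t m : ℤ) :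
    expC (some a) (kerC (some b) m) t + expC (some b) (kerC (some a) t) m = 0 := by
  unfold kerC
  by_cases hm : 0 ≤ m <;> by_cases ht : 0 ≤ t <;>
    simp only [hm, ht, if_true, if_false, expC_zero, expC_neg, expC_some_inv_pow hab,
      expC_some_inv_pow hab.symm, neg_zero, add_zero]
  lift m to ℕ using hm
  lift t to ℕ using ht
  simp only [Int.toNat_natCast]
  have h1 : a - b = -(b - a) := by ring
  have h2 : (m + t).choose m = (t + m).choose t := by
    rw [add_comm m t, Nat.choose_symm_add]
  rw [h1, inv_neg, neg_neg, h2, neg_pow _ (m + 1), neg_pow _ m, pow_succ (-1 : ℂ) m]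
  ring

lemma dMuFirst_cMuOuter (a b : CP1) (t m : ℤ) :
    dMuFirst cMuOuter a b t m = dLamFirst cLamOuter a b t m + deltaCoeff a b (t + m) := by
  rw [dMuFirst, dLamFirst, cLamOuter_eq, expC_neg, expC_neg, expC_pt_cMuOuter, expC_pt_cMuOuter,
    ← sub_eq_iff_eq_add', sub_neg_eq_add]
  cases a <;> cases b
  · rw [expC_kerC_none_none]
    simp [deltaCoeff, Pi.single_apply]
  · rw [expC_kerC_none_some]
    simp [deltaCoeff]
  · rw [add_comm, expC_kerC_none_some]
    simp [deltaCoeff]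
  · rename_i a b
    by_cases hab : a = b
    · subst hab
      rw [expC_kerC_self]
      simp [deltaCoeff, Pi.single_apply]
    · rw [expC_kerC_some_some hab]
      simp [deltaCoeff, hab]

/-- The effect of multiplication by the coordinate function on Laurent coefficients. -/
def mulXCoeff (a : CP1) (f : ℤ → ℂ) (t : ℤ) : ℂ :=
  match a with
  | some a => f (t - 1) + a * f t
  | none => f (t + 1)

lemma dMuFirst_sMuOuter_eq (a b : CP1) (t m : ℤ) :
    dMuFirst sMuOuter a b t m
      = (if t = 0 ∧ m = 0 then 1 else 0) + mulXCoeff a (dMuFirst cMuOuter a b · m) t := by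
  have h1 : expC a (if m = 0 then 1 else 0 : Rf) t = if t = 0 ∧ m = 0 then 1 else 0 := by
    by_cases hm : m = 0 <;> simp [hm, expC_one, expC_zero]
  rw [dMuFirst, sMuOuter_eq, expC_add, expC_one, expC_C_mul, expC_add, h1]
  cases a
  · rw [expC_none_X_mul]; rfl
  · rw [expC_some_X_mul]; rfl

lemma dLamFirst_sLamOuter_eq (a b : CP1) (t m : ℤ) :
    dLamFirst sLamOuter a b t m
      = (if t = 0 ∧ m = 0 then 1 else 0) + mulXCoeff a (dLamFirst cLamOuter a b · m) t := by
  have h1 : expC b (if t = 0 then 1 else 0 : Rf) m = if t = 0 ∧ m = 0 then 1 else 0 := by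
    by_cases ht : t = 0 <;> simp [ht, expC_one, expC_zero]
  rw [dLamFirst, sLamOuter_eq, expC_add, expC_one, expC_add, h1]
  cases a
  · rw [pt, Option.map_none, expC_none_X_mul]; rfl
  · rw [pt, Option.map_some, expC_some_X_mul, expC_add, RatFunc.algebraMap_eq_C, expC_C_mul,
      ← RatFunc.algebraMap_eq_C]
    rfl

lemma dMuFirst_sMuOuter (a b : CP1) (t m : ℤ) :
    dMuFirst sMuOuter a b t m
      = dLamFirst sLamOuter a b t m + mulXCoeff a (deltaCoeff a b) (t + m) := by
  rw [dMuFirst_sMuOuter_eq, dLamFirst_sLamOuter_eq, add_assoc]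
  congr 1
  cases a
  · simp only [mulXCoeff, dMuFirst_cMuOuter, add_right_comm]
  · simp only [mulXCoeff, dMuFirst_cMuOuter, sub_add_eq_add_sub]
    ring

lemma finite_support_deltaCoeff (a b : CP1) : (deltaCoeff a b).support.Finite := by
  unfold deltaCoeff
  split_ifs
  · cases a
    · exact (Set.finite_singleton _).subset Pi.support_single_subset
    · exact (Set.finite_singleton _).subset Pi.support_single_subset
  · simp

lemma finite_support_mulXCoeff (a : CP1) {f : ℤ → ℂ} (hf : f.support.Finite) :
    (mulXCoeff a f).support.Finite := by
  cases a with
  | none => exact hf.preimage (f := (· + 1)) (add_left_injective 1).injOn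
  | some a =>
    refine ((hf.preimage (f := (· - 1)) sub_left_injective.injOn).union hf).subset ?_
    intro t ht
    by_contra h
    simp only [Set.mem_union, Set.mem_preimage, Function.mem_support, not_or, not_not] at h
    exact ht (by simp [mulXCoeff, h.1, h.2])

lemma exists_dMuFirst_eq_zero (s : Rf2) (a b : CP1) :
    ∃ M : ℤ, ∀ t p, p < M → dMuFirst s a b t p = 0 := by
  obtain ⟨M, hM⟩ := exists_expC_eq_zero_of_lt (pt b) s
  exact ⟨M, fun t p hp => by rw [dMuFirst, hM p hp, expC_zero]⟩

lemma exists_dLamFirst_eq_zero (s : Rf2) (a b : CP1) :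
    ∃ M : ℤ, ∀ t p, t < M → dLamFirst s a b t p = 0 := by
  obtain ⟨M, hM⟩ := exists_expC_eq_zero_of_lt (pt a) s
  exact ⟨M, fun t p ht => by rw [dLamFirst, hM t ht, expC_zero]⟩

lemma finsum_eq_zero_of_antisymm {V : Type*} [AddCommGroup V] [Module ℂ V] (k : ℤ) (g : ℤ → V)
    (h : ∀ u, g (k - u) = -g u) : ∑ᶠ u, g u = 0 := by
  have h1 : ∑ᶠ u, g u = -∑ᶠ u, g u := by
    rw [← finsum_neg_distrib, ← finsum_comp_equiv (Equiv.subLeft k)]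
    exact finsum_congr h
  have h2 : (2 : ℂ) • ∑ᶠ u, g u = 0 := by
    rw [two_smul]
    nth_rewrite 1 [h1]
    exact neg_add_cancel _
  exact (smul_eq_zero.mp h2).resolve_left two_ne_zero

lemma finite_of_bounded {P : ℤ → Prop} {x y : ℤ} (hx : ∀ u, P u → x ≤ u) (hy : ∀ u, P u → u ≤ y) :
    {u | P u}.Finite :=
  (Set.finite_Icc x y).subset fun u hu => ⟨hx u hu, hy u hu⟩

lemma finsum_delta_bracket_eq_zero {A : Type*} [Ring A] [Algebra ℂ A] (q : ℤ → A) {K : ℤ}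
    (hq : ∀ n < K, q n = 0) (c : ℤ → ℂ) (s : Finset ℤ) (t m : ℤ) :
    ∑ᶠ u : ℤ, ((∑ i ∈ s, c i • q (m + u - i)) * q (t - u)
      - q (t - u) * ∑ i ∈ s, c i • q (m + u - i)) = 0 := by
  simp only [Finset.sum_mul, Finset.mul_sum, smul_mul_assoc, mul_smul_comm,
    ← Finset.sum_sub_distrib, ← smul_sub]
  rw [finsum_sum_comm]
  · refine Finset.sum_eq_zero fun i _ => ?_
    refine finsum_eq_zero_of_antisymm (t - m + i) _ fun u => ?_
    rw [← smul_neg, neg_sub, show m + (t - m + i - u) - i = t - u by ring,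
      show t - (t - m + i - u) = m + u - i by ring]
  · intro i _
    refine finite_of_bounded (x := K - m + i) (y := t - K) ?_ ?_ <;>
      intro u hu <;> by_contra h <;> apply hu
    · simp [hq (m + u - i) (by omega)]
    · simp [hq (t - u) (by omega)]

lemma TrIota_eq_add {N : ℕ} {d₁ d₂ : CP1 → CP1 → ℤ → ℤ → ℂ} {a b : CP1} {c : ℤ → ℂ}
    (hc : c.support.Finite) (h₁ : ∃ M : ℤ, ∀ t p, p < M → d₁ a b t p = 0)
    (h : ∀ t p, d₁ a b t p = d₂ a b t p + c (t + p)) (cpart : Bool) {Q : AdeleData N}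
    (hQ : LaurentBdd Q) (u m : ℤ) :
    TrIota d₁ cpart Q a b u m
      = TrIota d₂ cpart Q a b u m + ∑ i ∈ hc.toFinset, c i • Q b (m + u - i) := by
  obtain ⟨M, hM⟩ := h₁
  obtain ⟨K, hK⟩ := hQ b
  have hfin : {p : ℤ | c (u + p) ≠ 0}.Finite :=
    hc.preimage (f := (u + ·)) (add_right_injective u).injOn
  have hδ : (Function.support fun p : ℤ => c (u + p) • Q b (m - p)).Finite :=
    hfin.subset fun p hp hcp => hp (by simp [hcp])
  have hd : (Function.support fun p : ℤ => d₂ a b u p • Q b (m - p)).Finite := by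
    refine ((Set.finite_Icc M (m - K)).union hfin).subset fun p hp => ?_
    by_contra hp'
    simp only [Set.mem_union, Set.mem_Icc, Set.mem_ofPred_eq, not_or, not_not] at hp'
    have hd₂ : d₁ a b u p = d₂ a b u p := by rw [h, hp'.2, add_zero]
    by_cases hpM : p < M
    · exact hp (by simp [← hd₂, hM u p hpM])
    · exact hp (by simp [hK (m - p) (by omega)])
  have hsum : ∑ᶠ p : ℤ, c (u + p) • Q b (m - p)
      = ∑ i ∈ hc.toFinset, c i • Q b (m + u - i) := by
    rw [← finsum_eq_sum_of_support_subset]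
    · rw [← finsum_comp_equiv (f := fun i => c i • Q b (m + u - i)) (Equiv.addLeft u)]
      refine finsum_congr fun p => ?_
      rw [Equiv.coe_addLeft, show m + u - (u + p) = m - p by ring]
    · intro i hi
      simp only [Set.Finite.coe_toFinset]
      exact fun hci => hi (by simp [hci])
  simp only [TrIota, h, add_smul]
  rw [finsum_add_distrib hd hδ, hsum]
  abel

lemma brkt_TrIota_eq {N : ℕ} {d₁ d₂ : CP1 → CP1 → ℤ → ℤ → ℂ} {a : CP1} {c : ℤ → ℂ}
    (hc : c.support.Finite) (h₁ : ∃ M : ℤ, ∀ t p, p < M → d₁ a a t p = 0)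
    (h₂ : ∃ M : ℤ, ∀ t p, t < M → d₂ a a t p = 0)
    (h : ∀ t p, d₁ a a t p = d₂ a a t p + c (t + p)) (cpart : Bool) {Q : AdeleData N}
    (hQ : LaurentBdd Q) (t m : ℤ) :
    brkt (TrIota d₁ cpart Q a a) Q a t m = brkt (TrIota d₂ cpart Q a a) Q a t m := by
  obtain ⟨M, hM⟩ := h₂
  obtain ⟨K, hK⟩ := hQ a
  have hT : ∀ u, u < min M 0 → TrIota d₂ cpart Q a a u m = 0 := by
    intro u hu
    have hu0 : u ≠ 0 := by omega
    simp [TrIota, hu0, hM u _ (lt_of_lt_of_le hu (min_le_left _ _))]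
  have hq : ∀ u, t - K < u → Q a (t - u) = 0 := fun u hu => hK _ (by omega)
  obtain ⟨L, hL⟩ : ∃ L : ℤ, ∀ u < L, ∑ i ∈ hc.toFinset, c i • Q a (m + u - i) = 0 := by
    obtain ⟨B, hB⟩ := hc.toFinset.bddBelow
    refine ⟨K - m + B, fun u hu => Finset.sum_eq_zero fun i hi => ?_⟩
    have := hB hi
    rw [hK _ (by omega), smul_zero]
  have hfin₂ : (Function.support fun u : ℤ => TrIota d₂ cpart Q a a u m * Q a (t - u)
      - Q a (t - u) * TrIota d₂ cpart Q a a u m).Finite := by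
    refine finite_of_bounded (x := min M 0) (y := t - K) ?_ ?_ <;>
      intro u hu <;> by_contra hlt <;> apply hu
    · simp [hT u (not_le.mp hlt)]
    · simp [hq u (not_le.mp hlt)]
  have hfin : (Function.support fun u : ℤ =>
      (∑ i ∈ hc.toFinset, c i • Q a (m + u - i)) * Q a (t - u)
      - Q a (t - u) * ∑ i ∈ hc.toFinset, c i • Q a (m + u - i)).Finite := by
    refine finite_of_bounded (x := L) (y := t - K) ?_ ?_ <;>
      intro u hu <;> by_contra hlt <;> apply hu
    · simp only [hL u (not_le.mp hlt), zero_mul, mul_zero, sub_zero]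
    · simp [hq u (not_le.mp hlt)]
  simp only [brkt, TrIota_eq_add hc h₁ h cpart hQ, add_mul, mul_add, add_sub_add_comm]
  rw [finsum_add_distrib hfin₂ hfin, finsum_delta_bracket_eq_zero (Q a) hK, add_zero]

lemma brkt_TrIota_congr {N : ℕ} {d₁ d₂ : CP1 → CP1 → ℤ → ℤ → ℂ} {a b : CP1}
    (h : ∀ t p, d₁ a b t p = d₂ a b t p) (cpart : Bool) (Q : AdeleData N) (t m : ℤ) :
    brkt (TrIota d₁ cpart Q a b) Q a t m = brkt (TrIota d₂ cpart Q a b) Q a t m := by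
  simp only [brkt, TrIota, h]

/-- for both the rational and the trigonometric r-matrix, the two
orders of double expansion of the kernel give the same bracket with `Q`,
coefficientwise. -/
theorem iota_reorder_bracket (N : ℕ) (Q : AdeleData N) (hQ : IsAdele Q) :
    (∀ (a b : CP1) (t m : ℤ),
      brkt (TrIota (dMuFirst cMuOuter) false Q a b) Q a t m
        = brkt (TrIota (dLamFirst cLamOuter) false Q a b) Q a t m) ∧
    (∀ (a b : CP1) (t m : ℤ),
      brkt (TrIota (dMuFirst sMuOuter) true Q a b) Q a t m
        = brkt (TrIota (dLamFirst sLamOuter) true Q a b) Q a t m) := by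
  refine ⟨fun a b t m => ?_, fun a b t m => ?_⟩ <;> by_cases hab : a = b
  · subst hab
    exact brkt_TrIota_eq (finite_support_deltaCoeff a a) (exists_dMuFirst_eq_zero _ _ _)
      (exists_dLamFirst_eq_zero _ _ _) (dMuFirst_cMuOuter a a) _ hQ.1 t m
  · refine brkt_TrIota_congr (fun t p => ?_) _ _ _ _
    simp [dMuFirst_cMuOuter, deltaCoeff, hab]
  · subst hab
    exact brkt_TrIota_eq (finite_support_mulXCoeff a (finite_support_deltaCoeff a a))
      (exists_dMuFirst_eq_zero _ _ _) (exists_dLamFirst_eq_zero _ _ _)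
      (dMuFirst_sMuOuter a a) _ hQ.1 t m
  · refine brkt_TrIota_congr (fun t p => ?_) _ _ _ _
    cases a <;> simp [dMuFirst_sMuOuter, mulXCoeff, deltaCoeff, hab]

end
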